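/- For all constants c > 0 and K > 0 there exists N such that for all n = rm ≥ N with integers r ≥ 3, m ≥ 1 and integer d with 1 ≤ d ≤ m^{r−1} − 1 satisfying Λ ≥ c·r^{16}·m^{2−r}: ∫_{𝓑 \ U_n(ρ₀)} |F(θ)| dθ ≤ e^{−K·r·log n} · m^{(r−1)/2} · (2π/(Λ m^{r−1}))^{(n−r+1)/2}. -/

import Mathlib

open MeasureTheory Filter

/-- The edge density `λ = d / m^(r-1)`. -/
noncomputable def lam (r m d : ℕ) : ℝ := (d : ℝ) / (m : ℝ) ^ (r - 1)

/-- `Λ = λ(1−λ)`. -/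
noncomputable def Lam (r m d : ℕ) : ℝ := lam r m d * (1 - lam r m d)

/-- For an edge `e ∈ (Fin m)^r` and `θ ∈ ℝ^n` (vertices indexed by `Fin r × Fin m`,
class `t` being `{t} × Fin m`), the sum `Σ_{j∈e} θ_j`. -/
def edgeSum (r m : ℕ) (θ : Fin r × Fin m → ℝ) (e : Fin r → Fin m) : ℝ :=
  ∑ t : Fin r, θ (t, e t)

/-- The integrand `F(θ) = (∏_e (1 + λ(e^{iΣ_{j∈e}θ_j} − 1))) · e^{−i d Σ_j θ_j}`. -/
noncomputable def Ffun (r m d : ℕ) (θ : Fin r × Fin m → ℝ) : ℂ :=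
  (∏ e : Fin r → Fin m,
      (1 + (lam r m d : ℂ) * (Complex.exp (Complex.I * (edgeSum r m θ e : ℂ)) - 1))) *
    Complex.exp (-Complex.I * (d : ℂ) * ((∑ p : Fin r × Fin m, θ p : ℝ) : ℂ))

/-- Vertex `p` is one of the constrained coordinates `2m, 3m, …, rm`
(the last vertex of each class except the first). -/
def constrained (r m : ℕ) (p : Fin r × Fin m) : Prop := p.1.val ≠ 0 ∧ p.2.val = m - 1

instance (r m : ℕ) : DecidablePred (constrained r m) :=
  fun p => inferInstanceAs (Decidable (p.1.val ≠ 0 ∧ p.2.val = m - 1))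

/-- Extension by zero of a vector of free coordinates to all of `ℝ^n`;
(n−r+1)-dimensional integrals over subsets of `𝓑` are realised by pulling back along it. -/
def ext (r m : ℕ) (θ : {p : Fin r × Fin m // ¬ constrained r m p} → ℝ) :
    Fin r × Fin m → ℝ :=
  fun p => if h : constrained r m p then 0 else θ ⟨p, h⟩

/-- `ρ₀ = r^{5/2} (log n) / (Λ m^{r−1})^{1/2}`, with `n = r·m`. -/
noncomputable def rho0 (r m d : ℕ) : ℝ :=
  (r : ℝ) ^ ((5 : ℝ) / 2) * Real.log ((r : ℝ) * m) /
    Real.sqrt (Lam r m d * (m : ℝ) ^ (r - 1))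

/-- `U_n(ρ) = {x ∈ ℝ^n : ‖x‖_∞ ≤ ρ}`. -/
def Uball (r m : ℕ) (ρ : ℝ) : Set (Fin r × Fin m → ℝ) := {θ | ∀ p, |θ p| ≤ ρ}

/-- `𝓑 = {θ ∈ U_n(π) : θ_{2m} = ⋯ = θ_{rm} = 0}`. -/
def BSet (r m : ℕ) : Set (Fin r × Fin m → ℝ) :=
  {θ | (∀ p, |θ p| ≤ Real.pi) ∧ ∀ p, constrained r m p → θ p = 0}

/-- The circular distance `|x|_{2π} = min_{k∈ℤ} |x − 2πk|`. -/
noncomputable def circ (x : ℝ) : ℝ := ⨅ k : ℤ, |x - 2 * Real.pi * k|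

/-- The main factor `m^{(r−1)/2} (2π/(Λ m^{r−1}))^{(n−r+1)/2}` in the estimates. -/
noncomputable def denseBound (r m d : ℕ) : ℝ :=
  (m : ℝ) ^ (((r : ℝ) - 1) / 2) *
    (2 * Real.pi / (Lam r m d * (m : ℝ) ^ (r - 1))) ^
      ((((r * m : ℕ) : ℝ) - (r : ℝ) + 1) / 2)

lemma norm_one_add_mul_exp_sub_one_le (l x : ℝ) :
    ‖1 + (l : ℂ) * (Complex.exp (Complex.I * (x : ℂ)) - 1)‖ ≤
      Real.exp (-(l * (1 - l)) * (1 - Real.cos x)) := by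
  have h : ‖1 + (l : ℂ) * (Complex.exp (Complex.I * (x : ℂ)) - 1)‖ ^ 2 =
      1 - 2 * (l * (1 - l)) * (1 - Real.cos x) := by
    rw [mul_comm Complex.I, Complex.exp_mul_I, ← Complex.ofReal_cos, ← Complex.ofReal_sin,
      Complex.sq_norm, Complex.normSq_apply]
    have h := Real.sin_sq_add_cos_sq x
    generalize Real.cos x = a at h ⊢
    generalize Real.sin x = b at h ⊢
    simp
    linear_combination l ^ 2 * h
  refine le_of_sq_le_sq ?_ (Real.exp_pos _).le
  rw [h, ← Real.exp_nat_mul]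
  have := Real.add_one_le_exp (((2 : ℕ) : ℝ) * (-(l * (1 - l)) * (1 - Real.cos x)))
  push_cast at this ⊢
  linarith

lemma norm_Ffun_le (r m d : ℕ) (θ : Fin r × Fin m → ℝ) :
    ‖Ffun r m d θ‖ ≤ Real.exp (-(Lam r m d * ∑ e, (1 - Real.cos (edgeSum r m θ e)))) := by
  have h : ‖Complex.exp (-Complex.I * (d : ℂ) * ((∑ p : Fin r × Fin m, θ p : ℝ) : ℂ))‖ = 1 := by
    rw [Complex.norm_exp]
    simp
  rw [Ffun, norm_mul, h, mul_one, norm_prod, Finset.mul_sum, ← Finset.sum_neg_distrib,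
    Real.exp_sum]
  refine Finset.prod_le_prod (fun _ _ => norm_nonneg _) fun e _ => ?_
  refine (norm_one_add_mul_exp_sub_one_le _ _).trans_eq ?_
  rw [Lam]
  ring_nf

lemma sum_cos_edgeSum (r m : ℕ) (θ : Fin r × Fin m → ℝ) :
    ∑ e, Real.cos (edgeSum r m θ e) =
      (∏ t : Fin r, ∑ j : Fin m, Complex.exp ((θ (t, j) : ℂ) * Complex.I)).re := by
  rw [Finset.prod_univ_sum, Complex.re_sum, Fintype.piFinset_univ]
  refine Finset.sum_congr rfl fun e _ => ?_
  rw [← Complex.exp_sum, ← Finset.sum_mul, ← Complex.ofReal_sum, Complex.exp_ofReal_mul_I_re]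
  rfl

/-- Each class has a center such that the sum of `cos` over the class is the length of the sum
of the corresponding unit vectors. -/
lemma exists_centers (r m : ℕ) (θ : Fin r × Fin m → ℝ) :
    ∃ c : Fin r → ℝ, (∀ t, 0 ≤ ∑ j, Real.cos (θ (t, j) - c t)) ∧
      ∑ e, Real.cos (edgeSum r m θ e) =
        (∏ t, ∑ j, Real.cos (θ (t, j) - c t)) * Real.cos (∑ t, c t) := by
  set Z : Fin r → ℂ := fun t => ∑ j : Fin m, Complex.exp ((θ (t, j) : ℂ) * Complex.I) with hZ
  have hnorm : ∀ t, ∑ j, Real.cos (θ (t, j) - (Z t).arg) = ‖Z t‖ := by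
    intro t
    have h1 : Z t * Complex.exp (-((Z t).arg * Complex.I)) = (‖Z t‖ : ℂ) := by
      nth_rewrite 1 [← Complex.norm_mul_exp_arg_mul_I (Z t)]
      rw [mul_assoc, ← Complex.exp_add]
      simp
    have h2 := congrArg Complex.re h1
    rw [Complex.ofReal_re, hZ, Finset.sum_mul, Complex.re_sum] at h2
    rw [← h2]
    refine Finset.sum_congr rfl fun j _ => ?_
    rw [← Complex.exp_add, ← Complex.exp_ofReal_mul_I_re]
    congr 2
    push_cast
    ring
  refine ⟨fun t => (Z t).arg, fun t => ?_, ?_⟩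
  · rw [hnorm]
    exact norm_nonneg _
  · simp only [hnorm]
    rw [sum_cos_edgeSum]
    have h : ∏ t, Z t = ((∏ t, ‖Z t‖ : ℝ) : ℂ) *
        Complex.exp (((∑ t, (Z t).arg : ℝ) : ℂ) * Complex.I) := by
      conv_lhs => enter [2, t]; rw [← Complex.norm_mul_exp_arg_mul_I (Z t)]
      rw [Finset.prod_mul_distrib, ← Complex.exp_sum, ← Finset.sum_mul]
      push_cast
      rfl
    change (∏ t, Z t).re = _
    rw [h, Complex.re_ofReal_mul, Complex.exp_ofReal_mul_I_re]

lemma one_sub_sum_le_prod {ι : Type*} (s : Finset ι) (y : ι → ℝ)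
    (h0 : ∀ i ∈ s, 0 ≤ y i) (h1 : ∀ i ∈ s, y i ≤ 1) :
    1 - ∑ i ∈ s, y i ≤ ∏ i ∈ s, (1 - y i) := by
  classical
  induction s using Finset.induction_on with
  | empty => simp
  | insert a s ha ih =>
    rw [Finset.sum_insert ha, Finset.prod_insert ha]
    have ih' := ih (fun i hi => h0 i (Finset.mem_insert_of_mem hi))
      (fun i hi => h1 i (Finset.mem_insert_of_mem hi))
    have ha0 := h0 a (Finset.mem_insert_self a s)
    have ha1 := h1 a (Finset.mem_insert_self a s)
    have hs : 0 ≤ ∑ i ∈ s, y i :=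
      Finset.sum_nonneg fun i hi => h0 i (Finset.mem_insert_of_mem hi)
    nlinarith

lemma prod_one_sub_le_exp {ι : Type*} (s : Finset ι) (y : ι → ℝ) (h1 : ∀ i ∈ s, y i ≤ 1) :
    ∏ i ∈ s, (1 - y i) ≤ Real.exp (-∑ i ∈ s, y i) := by
  rw [← Finset.sum_neg_distrib, Real.exp_sum]
  refine Finset.prod_le_prod (fun i hi => sub_nonneg.2 (h1 i hi)) fun i _ => ?_
  linarith [Real.add_one_le_exp (-y i)]

lemma exp_neg_le_one_sub_add_sq {y : ℝ} (hy : 0 ≤ y) (hy1 : y ≤ 1) :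
    Real.exp (-y) ≤ 1 - y + y ^ 2 / 2 := by
  have h := Real.quadratic_le_exp_of_nonneg hy
  rw [Real.exp_neg, inv_le_comm₀ (Real.exp_pos _) (by nlinarith)]
  refine le_trans ?_ h
  rw [inv_le_iff_one_le_mul₀ (by nlinarith)]
  nlinarith [sq_nonneg (y ^ 2)]

/-- Lower bound for the energy `∑ e, (1 - cos S_e)` in terms of the deviations of the vertices
from the centers of their classes. -/
lemma energy_lower_bound (r m : ℕ) (hm : 1 ≤ m) (hr : 1 ≤ r) (θ : Fin r × Fin m → ℝ) :
    ∃ c : Fin r → ℝ, ∀ ε : ℝ, 0 ≤ ε → ε ≤ 1 / 2 →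
      (m : ℝ) ^ r * (ε / 2) ≤ ∑ e, (1 - Real.cos (edgeSum r m θ e)) ∨
      (1 - ε) * (m : ℝ) ^ (r - 1) * ∑ p : Fin r × Fin m, (1 - Real.cos (θ p - c p.1)) +
        (m : ℝ) ^ r / 2 * (1 - Real.cos (∑ t, c t)) ≤
          ∑ e, (1 - Real.cos (edgeSum r m θ e)) := by
  obtain ⟨c, hc0, hc⟩ := exists_centers r m θ
  refine ⟨c, fun ε hε hε2 => ?_⟩
  have hm0 : (0 : ℝ) < m := by exact_mod_cast hm
  set y : Fin r → ℝ := fun t => (∑ j, (1 - Real.cos (θ (t, j) - c t))) / m with hy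
  have hy0 : ∀ t, 0 ≤ y t := fun t =>
    div_nonneg (Finset.sum_nonneg fun j _ => by linarith [Real.cos_le_one (θ (t, j) - c t)])
      hm0.le
  have hcy : ∀ t, ∑ j, Real.cos (θ (t, j) - c t) = m * (1 - y t) := by
    intro t
    simp only [hy, Finset.sum_sub_distrib]
    field_simp
    simp
  have hy1 : ∀ t, y t ≤ 1 := by
    intro t
    have := hc0 t
    rw [hcy] at this
    linarith [nonneg_of_mul_nonneg_right this hm0]
  set P := ∏ t, (1 - y t) with hP
  set Y := ∑ t, y t with hY
  have hY0 : 0 ≤ Y := Finset.sum_nonneg fun t _ => hy0 t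
  have hE : ∑ e, (1 - Real.cos (edgeSum r m θ e)) =
      (m : ℝ) ^ r * ((1 - P) + P * (1 - Real.cos (∑ t, c t))) := by
    rw [Finset.sum_sub_distrib, hc]
    simp only [hcy, Finset.prod_mul_distrib]
    simp
    ring
  have hU : ∑ p : Fin r × Fin m, (1 - Real.cos (θ p - c p.1)) = m * Y := by
    rw [Fintype.sum_prod_type, hY, Finset.mul_sum]
    refine Finset.sum_congr rfl fun t _ => ?_
    simp only [hy]
    field_simp
  have hPle : P ≤ Real.exp (-Y) := prod_one_sub_le_exp _ _ fun t _ => hy1 t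
  have hPge : 1 - Y ≤ P := one_sub_sum_le_prod _ _ (fun t _ => hy0 t) fun t _ => hy1 t
  have hP0 : 0 ≤ P := Finset.prod_nonneg fun t _ => sub_nonneg.2 (hy1 t)
  have hC : 0 ≤ 1 - Real.cos (∑ t, c t) := by linarith [Real.cos_le_one (∑ t, c t)]
  have hmr : (m : ℝ) ^ r = (m : ℝ) ^ (r - 1) * m := by
    rw [← pow_succ, Nat.sub_add_cancel hr]
  rw [hE, hU]
  rcases le_or_gt Y ε with h | h
  · right
    have := exp_neg_le_one_sub_add_sq hY0 (by linarith)
    have h1 : (1 - ε) * Y ≤ 1 - P := by nlinarith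
    have h2 : 1 / 2 ≤ P := by linarith
    have h3 : (1 - ε) * Y + 1 / 2 * (1 - Real.cos (∑ t, c t)) ≤
        (1 - P) + P * (1 - Real.cos (∑ t, c t)) := by nlinarith
    have h4 := mul_le_mul_of_nonneg_left h3 (pow_nonneg hm0.le r)
    refine le_trans (le_of_eq ?_) h4
    rw [hmr]
    ring
  · left
    have h1 : P ≤ 1 - ε + ε ^ 2 / 2 :=
      (hPle.trans (Real.exp_le_exp.2 (by linarith))).trans
        (exp_neg_le_one_sub_add_sq hε (by linarith))
    refine mul_le_mul_of_nonneg_left ?_ (pow_nonneg hm0.le r)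
    nlinarith [mul_nonneg hP0 hC]

lemma abs_sin_add_le (x y : ℝ) : |Real.sin (x + y)| ≤ |Real.sin x| + |Real.sin y| := by
  rw [Real.sin_add]
  refine (abs_add_le _ _).trans ?_
  rw [abs_mul, abs_mul]
  have := abs_nonneg (Real.sin x)
  have := abs_nonneg (Real.sin y)
  nlinarith [Real.abs_cos_le_one x, Real.abs_cos_le_one y]

lemma abs_sin_sum_le {ι : Type*} (s : Finset ι) (x : ι → ℝ) :
    |Real.sin (∑ i ∈ s, x i)| ≤ ∑ i ∈ s, |Real.sin (x i)| := by
  classical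
  induction s using Finset.induction_on with
  | empty => simp
  | insert a s ha ih =>
    rw [Finset.sum_insert ha, Finset.sum_insert ha]
    exact (abs_sin_add_le _ _).trans (by gcongr)

lemma one_sub_cos_eq (x : ℝ) : 1 - Real.cos x = 2 * |Real.sin (x / 2)| ^ 2 := by
  rw [sq_abs, Real.sin_sq_eq_half_sub]
  ring_nf

/-- If a point of `𝓑` is outside `U_n(ρ)`, then some vertex deviates from the center of its class,
or the sum of the centers is far from `0`. -/
lemma exists_deviation_of_outside (r m : ℕ) (hr : 3 ≤ r) (hm : 1 ≤ m) (ρ : ℝ) (hρ : 0 ≤ ρ)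
    (θ : Fin r × Fin m → ℝ) (hθ : θ ∈ BSet r m \ Uball r m ρ) (c : Fin r → ℝ) :
    (∃ p, ρ ^ 2 / (16 * (r : ℝ) ^ 2) ≤ 1 - Real.cos (θ p - c p.1)) ∨
      ρ ^ 2 / (16 * (r : ℝ) ^ 2) ≤ 1 - Real.cos (∑ t, c t) := by
  obtain ⟨⟨hπ, hzero⟩, hout⟩ := hθ
  simp only [Uball, Set.mem_ofPred_eq, not_forall, not_le] at hout
  obtain ⟨p, hp⟩ := hout
  have hr0 : (3 : ℝ) ≤ r := by exact_mod_cast hr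
  set s := ρ / (4 * Real.sqrt 2 * r) with hs
  have hs0 : 0 ≤ s := by positivity
  have hs2 : 2 * s ^ 2 = ρ ^ 2 / (16 * (r : ℝ) ^ 2) := by
    rw [hs, div_pow, mul_pow, mul_pow, Real.sq_sqrt (by norm_num)]
    field_simp
    norm_num
  have key : ∀ x : ℝ, ρ ^ 2 / (16 * (r : ℝ) ^ 2) ≤ 1 - Real.cos x ∨ |Real.sin (x / 2)| ≤ s := by
    intro x
    rw [one_sub_cos_eq, ← hs2]
    rcases le_total s |Real.sin (x / 2)| with h | h
    · left; gcongr
    · right; exact h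
  by_contra hcon
  rw [not_or, not_exists] at hcon
  obtain ⟨h1, h2⟩ := hcon
  replace h1 : ∀ q : Fin r × Fin m, |Real.sin ((θ q - c q.1) / 2)| ≤ s := fun q =>
    (key _).resolve_left (h1 q)
  replace h2 := (key _).resolve_left h2
  have hc : ∀ t : Fin r, t.val ≠ 0 → |Real.sin (c t / 2)| ≤ s := by
    intro t ht
    have h3 := h1 (t, ⟨m - 1, by omega⟩)
    rw [hzero (t, ⟨m - 1, by omega⟩) ⟨ht, rfl⟩] at h3
    simpa [neg_div] using h3
  have hsin : |Real.sin (θ p / 2)| ≤ (r + 1) * s := by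
    by_cases hp0 : p.1.val = 0
    · have hdecomp : θ p / 2 = (θ p - c p.1) / 2 + ((∑ t, c t) / 2 +
          -∑ t ∈ Finset.univ.erase p.1, c t / 2) := by
        rw [← Finset.add_sum_erase _ _ (Finset.mem_univ p.1), ← Finset.sum_div]
        ring
      rw [hdecomp]
      refine (abs_sin_add_le _ _).trans ?_
      have h4 : |Real.sin (∑ t ∈ Finset.univ.erase p.1, c t / 2)| ≤ (r - 1) * s := by
        refine (abs_sin_sum_le _ _).trans ?_
        refine (Finset.sum_le_card_nsmul _ _ s fun t ht => hc t ?_).trans ?_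
        · intro h0
          exact Finset.ne_of_mem_erase ht (Fin.ext (h0.trans hp0.symm))
        · rw [Finset.card_erase_of_mem (Finset.mem_univ _), Finset.card_univ, Fintype.card_fin,
            nsmul_eq_mul, Nat.cast_sub (by omega)]
          simp
      have h5 := abs_sin_add_le ((∑ t, c t) / 2) (-∑ t ∈ Finset.univ.erase p.1, c t / 2)
      rw [Real.sin_neg, abs_neg] at h5
      have := h1 p
      linarith
    · have hdecomp : θ p / 2 = (θ p - c p.1) / 2 + c p.1 / 2 := by ring
      rw [hdecomp]
      refine (abs_sin_add_le _ _).trans ?_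
      have := h1 p
      have := hc p.1 hp0
      nlinarith
  have hquad := Real.cos_le_one_sub_mul_cos_sq (hπ p)
  have hv := one_sub_cos_eq (θ p)
  have hsq : |Real.sin (θ p / 2)| ^ 2 ≤ ((r + 1) * s) ^ 2 := by gcongr
  have hρ2 : ρ ^ 2 < θ p ^ 2 := by
    rw [← sq_abs (θ p)]
    gcongr
  have hle : 2 * ((r + 1) * s) ^ 2 ≤ ρ ^ 2 / 9 := by
    have : 2 * ((r + 1) * s) ^ 2 = (r + 1) ^ 2 * (ρ ^ 2 / (16 * (r : ℝ) ^ 2)) := by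
      rw [← hs2]; ring
    rw [this, ← mul_div_assoc, div_le_div_iff₀ (by positivity) (by norm_num)]
    nlinarith [mul_nonneg (sq_nonneg ρ) (by nlinarith : (0 : ℝ) ≤ 16 * r ^ 2 - 9 * (r + 1) ^ 2)]
  have hpi : 1 / 9 ≤ 2 / Real.pi ^ 2 := by
    rw [div_le_div_iff₀ (by norm_num) (by positivity)]
    nlinarith [Real.pi_lt_four, Real.pi_pos]
  nlinarith [mul_le_mul_of_nonneg_right hpi (sq_nonneg (θ p))]

/-- Lebesgue measure on the interval `[-π, π]`. -/
noncomputable abbrev arcMeasure : Measure ℝ := volume.restrict (Set.Icc (-Real.pi) Real.pi)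

lemma integral_arcMeasure (f : ℝ → ℝ) :
    ∫ x, f x ∂arcMeasure = ∫ x in (-Real.pi)..Real.pi, f x := by
  rw [intervalIntegral.integral_of_le (by linarith [Real.pi_pos]), integral_Icc_eq_integral_Ioc]

lemma integral_arcMeasure_const (a : ℝ) : ∫ _, a ∂arcMeasure = 2 * Real.pi * a := by
  rw [integral_arcMeasure, intervalIntegral.integral_const, smul_eq_mul]
  ring

lemma measureReal_pi_arcMeasure_univ (ι : Type*) [Fintype ι] :
    (Measure.pi fun _ : ι => arcMeasure).real Set.univ = (2 * Real.pi) ^ Fintype.card ι := by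
  simp only [Measure.real, Measure.pi_univ, Measure.restrict_apply_univ, Real.volume_Icc,
    Finset.prod_const, Finset.card_univ, ENNReal.toReal_pow]
  rw [ENNReal.toReal_ofReal (by linarith [Real.pi_pos])]
  ring

lemma Continuous.integrable_arcMeasure {f : ℝ → ℝ} (hf : Continuous f) :
    Integrable f arcMeasure :=
  hf.continuousOn.integrableOn_compact isCompact_Icc

lemma Function.Periodic.integral_arcMeasure_sub {f : ℝ → ℝ}
    (hf : Function.Periodic f (2 * Real.pi)) (a : ℝ) :
    ∫ x, f (x - a) ∂arcMeasure = ∫ x, f x ∂arcMeasure := by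
  rw [integral_arcMeasure, integral_arcMeasure, intervalIntegral.integral_comp_sub_right]
  convert hf.intervalIntegral_add_eq (-Real.pi - a) (-Real.pi) using 2 <;> ring

lemma integral_exp_one_sub_cos_le (q ε : ℝ) (hq : 0 < q) (hε : 0 < ε) (hε1 : ε ≤ 1 / 2) :
    ∫ x, Real.exp (-(q * (1 - Real.cos x))) ∂arcMeasure ≤
      Real.sqrt (2 * Real.pi / (q * (1 - ε))) + 2 * Real.pi * Real.exp (-(q * ε / 5)) := by
  set b := q * (1 - ε) / 2 with hb
  have hb0 : 0 < b := by
    have : 0 < 1 - ε := by linarith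
    positivity
  have hpt : ∀ x ∈ Set.Icc (-Real.pi) Real.pi, Real.exp (-(q * (1 - Real.cos x))) ≤
      Real.exp (-b * x ^ 2) + Real.exp (-(q * ε / 5)) := by
    intro x hx
    rcases le_or_gt (x ^ 2) ε with h | h
    · refine le_add_of_le_of_nonneg (Real.exp_le_exp.2 ?_) (Real.exp_pos _).le
      have hx1 : |x| ≤ 1 := by rw [← sq_le_one_iff_abs_le_one]; linarith
      have h1 := (abs_le.1 (Real.cos_bound hx1)).2
      have h4 : |x| ^ 4 = (x ^ 2) ^ 2 := by rw [← sq_abs x]; ring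
      rw [h4] at h1
      have h2 : (1 - ε) / 2 * x ^ 2 ≤ 1 - Real.cos x := by nlinarith [sq_nonneg x]
      have := mul_le_mul_of_nonneg_left h2 hq.le
      rw [hb]
      linarith
    · refine le_add_of_nonneg_of_le (Real.exp_pos _).le (Real.exp_le_exp.2 ?_)
      have h1 := Real.cos_le_one_sub_mul_cos_sq (abs_le.2 hx)
      have hpi : 1 / 5 ≤ 2 / Real.pi ^ 2 := by
        rw [div_le_div_iff₀ (by norm_num) (by positivity)]
        nlinarith [Real.pi_lt_d2, Real.pi_pos]
      have h2 : ε / 5 ≤ 1 - Real.cos x := by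
        nlinarith [mul_le_mul_of_nonneg_right hpi (sq_nonneg x)]
      have := mul_le_mul_of_nonneg_left h2 hq.le
      linarith
  have hg := integrable_exp_neg_mul_sq hb0
  have hc1 : Integrable (fun _ : ℝ => Real.exp (-(q * ε / 5))) arcMeasure := by fun_prop
  calc ∫ x, Real.exp (-(q * (1 - Real.cos x))) ∂arcMeasure
      ≤ ∫ x, (Real.exp (-b * x ^ 2) + Real.exp (-(q * ε / 5))) ∂arcMeasure :=
        setIntegral_mono_on (Continuous.integrable_arcMeasure (by fun_prop))
          (Continuous.integrable_arcMeasure (by fun_prop)) measurableSet_Icc hpt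
    _ = ∫ x, Real.exp (-b * x ^ 2) ∂arcMeasure + 2 * Real.pi * Real.exp (-(q * ε / 5)) := by
        rw [integral_add hg.restrict hc1, integral_arcMeasure_const]
    _ ≤ _ := by
        gcongr
        refine (setIntegral_le_integral hg
          (Eventually.of_forall fun x => (Real.exp_pos _).le)).trans_eq ?_
        rw [integral_gaussian, hb]
        congr 1
        field_simp

lemma one_sub_cos_add_add_one_sub_cos_sub_le (x s : ℝ) :
    (1 - Real.cos (x + s)) + (1 - Real.cos (x - s)) ≤
      2 * (1 - Real.cos x) + s ^ 2 := by
  rw [Real.cos_add, Real.cos_sub]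
  have h1 := Real.one_sub_sq_div_two_le_cos (x := s)
  nlinarith [Real.cos_le_one x, Real.cos_le_one s]

lemma two_mul_exp_le (a b z : ℝ) (h : 2 * z ≤ a + b) :
    2 * Real.exp z ≤ Real.exp a + Real.exp b := by
  have h1 := Real.add_one_le_exp (a - z)
  have h2 := Real.add_one_le_exp (b - z)
  have ha : Real.exp a = Real.exp z * Real.exp (a - z) := by rw [← Real.exp_add]; ring_nf
  have hb : Real.exp b = Real.exp z * Real.exp (b - z) := by rw [← Real.exp_add]; ring_nf
  rw [ha, hb]
  nlinarith [Real.exp_pos z]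

/-- A periodic Gaussian weight with an arbitrary center is dominated by the average over all
centers. -/
lemma exp_le_sqrt_mul_integral_centers {ι : Type*} (s : Finset ι) (a x : ι → ℝ) (q M c₀ : ℝ)
    (hq : 0 < q) (ha : ∀ i ∈ s, 0 ≤ a i) (haM : ∑ i ∈ s, a i ≤ M) (hqM : 1 ≤ q * M) :
    Real.exp (-(q * ∑ i ∈ s, a i * (1 - Real.cos (x i - c₀)))) ≤
      Real.sqrt (q * M) *
        ∫ c, Real.exp (-(q * ∑ i ∈ s, a i * (1 - Real.cos (x i - c)))) ∂arcMeasure := by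
  set U : ℝ → ℝ := fun c => ∑ i ∈ s, a i * (1 - Real.cos (x i - c)) with hU
  set g : ℝ → ℝ := fun c => Real.exp (-(q * U c)) with hg
  have hgc : Continuous g := by fun_prop
  have hper : Function.Periodic g (2 * Real.pi) := by
    intro c
    simp only [hg, hU]
    simp_rw [← sub_sub, Real.cos_sub_two_pi]
  set w := Real.sqrt (q * M) with hw
  have hw1 : 1 ≤ w := Real.one_le_sqrt.2 hqM
  have hw2 : w ^ 2 = q * M := Real.sq_sqrt (by linarith)
  set η := 1 / w with hη
  have hη0 : 0 < η := by positivity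
  have hη1 : η ≤ 1 := by rw [hη, div_le_one (by positivity)]; exact hw1
  have hηπ : η ≤ Real.pi := by linarith [Real.pi_gt_three]
  have hUs : ∀ t, U (c₀ + t) + U (c₀ - t) ≤ 2 * U c₀ + M * t ^ 2 := by
    intro t
    simp only [hU]
    rw [← Finset.sum_add_distrib, Finset.mul_sum]
    refine le_trans (Finset.sum_le_sum (g := fun i =>
      2 * (a i * (1 - Real.cos (x i - c₀))) + a i * t ^ 2) fun i hi => ?_) ?_
    · have := mul_le_mul_of_nonneg_left
        (one_sub_cos_add_add_one_sub_cos_sub_le (x i - c₀) t) (ha i hi)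
      rw [show x i - (c₀ + t) = x i - c₀ - t by ring, show x i - (c₀ - t) = x i - c₀ + t by ring]
      linarith
    · rw [Finset.sum_add_distrib, ← Finset.sum_mul]
      gcongr
  have hlow : ∀ t ∈ Set.Icc (-η) η,
      2 * (Real.exp (-(1 / 2)) * g c₀) ≤ g (c₀ + t) + g (c₀ - t) := by
    intro t ht
    have ht2 : q * M * t ^ 2 ≤ 1 := by
      have : t ^ 2 ≤ η ^ 2 := sq_le_sq' ht.1 ht.2
      calc q * M * t ^ 2 ≤ w ^ 2 * η ^ 2 := by rw [hw2]; gcongr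
        _ = 1 := by rw [hη]; field_simp
    simp only [hg]
    rw [← Real.exp_add]
    apply two_mul_exp_le
    nlinarith [mul_le_mul_of_nonneg_left (hUs t) hq.le]
  have h1 : ∫ t in (-Real.pi)..Real.pi, g (c₀ + t) = ∫ c, g c ∂arcMeasure := by
    rw [intervalIntegral.integral_comp_add_left, integral_arcMeasure]
    convert hper.intervalIntegral_add_eq (c₀ + -Real.pi) (-Real.pi) using 2 <;> ring
  have h2 : ∫ t in (-Real.pi)..Real.pi, g (c₀ - t) = ∫ c, g c ∂arcMeasure := by
    rw [intervalIntegral.integral_comp_sub_left, integral_arcMeasure]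
    convert hper.intervalIntegral_add_eq (c₀ - Real.pi) (-Real.pi) using 2 <;> ring
  have h3 : ∫ t in (-η)..η, 2 * (Real.exp (-(1 / 2)) * g c₀) ≤ 2 * ∫ c, g c ∂arcMeasure := by
    have h4 : 2 * ∫ c, g c ∂arcMeasure =
        ∫ t in (-Real.pi)..Real.pi, (g (c₀ + t) + g (c₀ - t)) := by
      rw [intervalIntegral.integral_add (Continuous.intervalIntegrable (by fun_prop) _ _)
        (Continuous.intervalIntegrable (by fun_prop) _ _), h1, h2]
      ring
    rw [h4]
    refine (intervalIntegral.integral_mono_on (g := fun t => g (c₀ + t) + g (c₀ - t))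
      (by linarith) (Continuous.intervalIntegrable (by fun_prop) _ _)
      (Continuous.intervalIntegrable (by fun_prop) _ _) hlow).trans ?_
    refine intervalIntegral.integral_mono_interval (by linarith) (by linarith) (by linarith)
      (Eventually.of_forall fun t => add_nonneg (Real.exp_pos _).le (Real.exp_pos _).le)
      (Continuous.intervalIntegrable (by fun_prop) _ _)
  rw [intervalIntegral.integral_const, smul_eq_mul] at h3
  have he : 1 / 2 ≤ Real.exp (-(1 / 2)) := by linarith [Real.add_one_le_exp (-(1 / 2 : ℝ))]
  have hg0 : 0 < g c₀ := Real.exp_pos _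
  change g c₀ ≤ w * ∫ c, g c ∂arcMeasure
  have h5 : η * g c₀ ≤ ∫ c, g c ∂arcMeasure := by
    have : η * (1 / 2 * g c₀) ≤ η * (Real.exp (-(1 / 2)) * g c₀) := by gcongr
    linarith
  calc g c₀ = w * (η * g c₀) := by rw [hη]; field_simp
    _ ≤ _ := by gcongr

/-- Version of `exp_le_sqrt_mul_integral_centers` for several classes. -/
lemma exp_le_sqrt_pow_mul_integral_centers {ι κ : Type*} [Fintype ι] [Fintype κ] [DecidableEq κ]
    (τ : ι → κ) (a x : ι → ℝ) (c₀ : κ → ℝ) (q M : ℝ) (hq : 0 < q) (ha : ∀ i, 0 ≤ a i)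
    (haM : ∀ t, ∑ i with τ i = t, a i ≤ M) (hqM : 1 ≤ q * M) :
    Real.exp (-(q * ∑ i, a i * (1 - Real.cos (x i - c₀ (τ i))))) ≤
      Real.sqrt (q * M) ^ Fintype.card κ *
        ∫ c : κ → ℝ, Real.exp (-(q * ∑ i, a i * (1 - Real.cos (x i - c (τ i)))))
          ∂Measure.pi fun _ => arcMeasure := by
  have hsplit : ∀ c : κ → ℝ, Real.exp (-(q * ∑ i, a i * (1 - Real.cos (x i - c (τ i))))) =
      ∏ t, Real.exp (-(q * ∑ i with τ i = t, a i * (1 - Real.cos (x i - c t)))) := by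
    intro c
    rw [← Real.exp_sum, ← Finset.sum_fiberwise Finset.univ τ, Finset.mul_sum,
      ← Finset.sum_neg_distrib]
    congr 1
    refine Finset.sum_congr rfl fun t _ => ?_
    congr 2
    refine Finset.sum_congr rfl fun i hi => ?_
    rw [(Finset.mem_filter.1 hi).2]
  simp_rw [hsplit]
  rw [integral_fintype_prod_eq_prod (𝕜 := ℝ) (fun t y =>
      Real.exp (-(q * ∑ i with τ i = t, a i * (1 - Real.cos (x i - y))))),
    ← Finset.card_univ, ← Finset.prod_const, ← Finset.prod_mul_distrib]
  exact Finset.prod_le_prod (fun _ _ => (Real.exp_pos _).le) fun t _ =>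
    exp_le_sqrt_mul_integral_centers _ a x q M (c₀ t) hq (fun i _ => ha i) (haM t) hqM

lemma integral_integral_centers {ι κ : Type*} [Fintype ι] [Fintype κ]
    (τ : ι → κ) (a : ι → ℝ) (q : ℝ) (hq : 0 < q) (ha : ∀ i, 0 ≤ a i) :
    Integrable (fun x : ι → ℝ => ∫ c : κ → ℝ,
        Real.exp (-(q * ∑ i, a i * (1 - Real.cos (x i - c (τ i)))))
          ∂Measure.pi fun _ => arcMeasure) (Measure.pi fun _ => arcMeasure) ∧
    ∫ x : ι → ℝ, ∫ c : κ → ℝ, Real.exp (-(q * ∑ i, a i * (1 - Real.cos (x i - c (τ i)))))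
        ∂(Measure.pi fun _ => arcMeasure) ∂(Measure.pi fun _ => arcMeasure) =
      (2 * Real.pi) ^ Fintype.card κ *
        ∏ i, ∫ y, Real.exp (-(q * (a i * (1 - Real.cos y)))) ∂arcMeasure := by
  have hint : Integrable (Function.uncurry fun (x : ι → ℝ) (c : κ → ℝ) =>
      Real.exp (-(q * ∑ i, a i * (1 - Real.cos (x i - c (τ i))))))
      ((Measure.pi fun _ => arcMeasure).prod (Measure.pi fun _ => arcMeasure)) := by
    refine Integrable.of_bound (Continuous.aestronglyMeasurable ?_) 1
      (Eventually.of_forall fun p => ?_)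
    · unfold Function.uncurry
      fun_prop
    · rw [Function.uncurry, Real.norm_of_nonneg (Real.exp_pos _).le, Real.exp_le_one_iff]
      have : 0 ≤ ∑ i, a i * (1 - Real.cos (p.1 i - p.2 (τ i))) :=
        Finset.sum_nonneg fun i _ => mul_nonneg (ha i) (sub_nonneg.2 (Real.cos_le_one _))
      nlinarith
  refine ⟨hint.integral_prod_left, ?_⟩
  rw [integral_integral_swap hint]
  have hinner : ∀ c : κ → ℝ, ∫ x : ι → ℝ,
      Real.exp (-(q * ∑ i, a i * (1 - Real.cos (x i - c (τ i)))))
        ∂(Measure.pi fun _ => arcMeasure) =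
      ∏ i, ∫ y, Real.exp (-(q * (a i * (1 - Real.cos y)))) ∂arcMeasure := by
    intro c
    simp_rw [Finset.mul_sum, ← Finset.sum_neg_distrib, Real.exp_sum]
    rw [integral_fintype_prod_eq_prod (𝕜 := ℝ) (fun i y =>
      Real.exp (-(q * (a i * (1 - Real.cos (y - c (τ i)))))))]
    refine Finset.prod_congr rfl fun i _ => ?_
    exact Function.Periodic.integral_arcMeasure_sub
      (f := fun y => Real.exp (-(q * (a i * (1 - Real.cos y)))))
      (fun y => by simp only [Real.cos_add_two_pi]) _
  simp_rw [hinner]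
  rw [integral_const, smul_eq_mul]
  rw [measureReal_pi_arcMeasure_univ]

lemma card_free (r m : ℕ) (hr : 1 ≤ r) (hm : 1 ≤ m) :
    Fintype.card {p : Fin r × Fin m // ¬ constrained r m p} + r = r * m + 1 := by
  have h1 : Fintype.card {p : Fin r × Fin m // constrained r m p} + 1 = r := by
    have e : {p : Fin r × Fin m // constrained r m p} ≃ {t : Fin r // ¬ t = ⟨0, hr⟩} :=
      { toFun := fun p => ⟨p.1.1, fun h => p.2.1 (congrArg Fin.val h)⟩
        invFun := fun t => ⟨(t.1, ⟨m - 1, by omega⟩), fun h => t.2 (Fin.ext h), rfl⟩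
        left_inv := fun p => Subtype.ext (Prod.ext rfl (Fin.ext p.2.2.symm))
        right_inv := fun t => rfl }
    rw [Fintype.card_congr e, Fintype.card_subtype_compl, Fintype.card_subtype_eq,
      Fintype.card_fin]
    omega
  have h2 := Fintype.card_subtype_compl (constrained r m)
  have h3 := Fintype.card_subtype_le (constrained r m)
  rw [Fintype.card_prod, Fintype.card_fin, Fintype.card_fin] at h2 h3
  omega

lemma exp_energy_le (r m d : ℕ) (hr : 3 ≤ r) (hm : 1 ≤ m) (Q ε ρ : ℝ)
    (hQ : Q = Lam r m d * (m : ℝ) ^ (r - 1)) (hQ0 : 0 < Q) (hε : 0 ≤ ε) (hε1 : ε ≤ 1 / 2)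
    (hρ : 0 ≤ ρ) (θ : Fin r × Fin m → ℝ) (hθ : θ ∈ BSet r m \ Uball r m ρ) :
    ∃ c : Fin r → ℝ, ‖Ffun r m d θ‖ ≤ Real.exp (-(Q * m * ε / 2)) +
      Real.exp (-(Q * ρ ^ 2 / (32 * (r : ℝ) ^ 2))) * ∑ p' : Fin r × Fin m,
        Real.exp (-((1 - ε) * Q * ∑ p : Fin r × Fin m,
          (if p = p' then 0 else 1) * (1 - Real.cos (θ p - c p.1)))) := by
  obtain ⟨c, hc⟩ := energy_lower_bound r m hm (by omega) θ
  refine ⟨c, (norm_Ffun_le r m d θ).trans ?_⟩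
  have hm0 : (0 : ℝ) < m := by exact_mod_cast hm
  have hm1 : (1 : ℝ) ≤ m := by exact_mod_cast hm
  have hmr : (m : ℝ) ^ r = (m : ℝ) ^ (r - 1) * m := by
    rw [← pow_succ, Nat.sub_add_cancel (by omega)]
  have hΛ : 0 ≤ Lam r m d := by
    rw [hQ] at hQ0
    exact (pos_of_mul_pos_left hQ0 (pow_nonneg hm0.le _)).le
  set E := ∑ e, (1 - Real.cos (edgeSum r m θ e))
  set v : Fin r × Fin m → ℝ := fun p => 1 - Real.cos (θ p - c p.1) with hv
  have hv0 : ∀ p, 0 ≤ v p := fun p => sub_nonneg.2 (Real.cos_le_one _)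
  set W : Fin r × Fin m → ℝ := fun p' => ∑ p, (if p = p' then 0 else 1) * v p with hW
  have hWv : ∀ p', ∑ p, v p = v p' + W p' := by
    intro p'
    simp only [hW, ite_mul, zero_mul, one_mul]
    rw [← Finset.add_sum_erase _ _ (Finset.mem_univ p')]
    congr 1
    rw [← Finset.add_sum_erase _ _ (Finset.mem_univ p'), if_pos rfl, zero_add]
    exact Finset.sum_congr rfl fun p hp => (if_neg (Finset.ne_of_mem_erase hp)).symm
  set G := Q * ρ ^ 2 / (32 * (r : ℝ) ^ 2) with hG
  have hG2 : G = Q * (ρ ^ 2 / (16 * (r : ℝ) ^ 2)) / 2 := by rw [hG]; ring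
  rcases hc ε hε hε1 with h | h
  · refine le_add_of_le_of_nonneg (Real.exp_le_exp.2 (neg_le_neg ?_)) (mul_nonneg
      (Real.exp_pos _).le (Finset.sum_nonneg fun _ _ => (Real.exp_pos _).le))
    have := mul_le_mul_of_nonneg_left h hΛ
    rw [hmr] at this
    rw [hQ]
    linarith
  · refine le_add_of_nonneg_of_le (Real.exp_pos _).le ?_
    have hE : (1 - ε) * Q * ∑ p, v p + Q * m / 2 * (1 - Real.cos (∑ t, c t)) ≤
        Lam r m d * E := by
      have := mul_le_mul_of_nonneg_left h hΛ
      rw [hmr] at this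
      rw [hQ]
      refine le_trans (le_of_eq ?_) this
      simp only [hv]
      ring
    have hC : 0 ≤ 1 - Real.cos (∑ t, c t) := sub_nonneg.2 (Real.cos_le_one _)
    have hq0 : 0 ≤ (1 - ε) * Q := mul_nonneg (by linarith) hQ0.le
    have hq : Q / 2 ≤ (1 - ε) * Q := by nlinarith
    obtain ⟨p', hp'⟩ : ∃ p', G + (1 - ε) * Q * W p' ≤ Lam r m d * E := by
      rcases exists_deviation_of_outside r m hr hm ρ hρ θ hθ c with ⟨p', hp'⟩ | hsum
      · refine ⟨p', ?_⟩
        have h1 := mul_le_mul_of_nonneg_left hp' (by positivity : 0 ≤ Q / 2)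
        have h2 := mul_le_mul_of_nonneg_right hq (hv0 p')
        have h3 : 0 ≤ Q * m / 2 * (1 - Real.cos (∑ t, c t)) := by positivity
        rw [hWv p'] at hE
        rw [hG2]
        change Q / 2 * (ρ ^ 2 / (16 * (r : ℝ) ^ 2)) ≤ Q / 2 * v p' at h1
        linarith
      · refine ⟨(⟨0, by omega⟩, ⟨0, by omega⟩), ?_⟩
        rw [hWv (⟨0, by omega⟩, ⟨0, by omega⟩)] at hE
        have h1 := mul_le_mul_of_nonneg_left hsum (by positivity : 0 ≤ Q / 2)
        have h2 : Q / 2 * (1 - Real.cos (∑ t, c t)) ≤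
            Q * m / 2 * (1 - Real.cos (∑ t, c t)) := by
          gcongr
          nlinarith
        have h3 := mul_nonneg hq0 (hv0 (⟨0, by omega⟩, ⟨0, by omega⟩))
        rw [hG2]
        linarith
    calc Real.exp (-(Lam r m d * E)) ≤ Real.exp (-G) * Real.exp (-((1 - ε) * Q * W p')) := by
          rw [← Real.exp_add]
          exact Real.exp_le_exp.2 (by linarith)
      _ ≤ _ := by
          gcongr
          exact Finset.single_le_sum
            (f := fun p' => Real.exp (-((1 - ε) * Q * W p'))) (fun _ _ => (Real.exp_pos _).le)
            (Finset.mem_univ p')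

lemma prod_integral_le {ι : Type*} [Fintype ι] {α : Type*} [DecidableEq α] (j : ι → α)
    (hj : Function.Injective j) (p' : α) (q I : ℝ)
    (hI : ∫ y, Real.exp (-(q * (1 - Real.cos y))) ∂arcMeasure ≤ I) (hI0 : 0 < I)
    (hIπ : I ≤ 2 * Real.pi) :
    ∏ i, ∫ y, Real.exp (-(q * ((if j i = p' then 0 else 1) * (1 - Real.cos y)))) ∂arcMeasure ≤
      2 * Real.pi / I * I ^ Fintype.card ι := by
  classical
  have h1 : 1 ≤ 2 * Real.pi / I := (one_le_div hI0).2 hIπ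
  calc _ ≤ ∏ i, ((if j i = p' then 2 * Real.pi / I else 1) * I) := by
        refine Finset.prod_le_prod (fun i _ => integral_nonneg fun _ => (Real.exp_pos _).le)
          fun i _ => ?_
        split_ifs with h
        · simp only [zero_mul, mul_zero, neg_zero, Real.exp_zero]
          rw [integral_arcMeasure_const, div_mul_cancel₀ _ hI0.ne', mul_one]
        · simpa using hI
    _ = (∏ i, if j i = p' then 2 * Real.pi / I else 1) * I ^ Fintype.card ι := by
        rw [Finset.prod_mul_distrib, Finset.prod_const, Finset.card_univ]
    _ ≤ _ := by
        gcongr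
        by_cases h : ∃ i₀, j i₀ = p'
        · obtain ⟨i₀, rfl⟩ := h
          simp [hj.eq_iff]
        · push Not at h
          simpa [h] using h1

lemma ext_coe (r m : ℕ) (θ : {p : Fin r × Fin m // ¬ constrained r m p} → ℝ)
    (i : {p : Fin r × Fin m // ¬ constrained r m p}) : ext r m θ i = θ i := by
  rw [ext, dif_neg i.2]

lemma continuous_ext (r m : ℕ) : Continuous (ext r m) := by
  refine continuous_pi fun p => ?_
  unfold ext
  split_ifs
  · exact continuous_const
  · exact continuous_apply _

lemma measurableSet_outside (r m : ℕ) (ρ : ℝ) :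
    MeasurableSet (ext r m ⁻¹' (BSet r m \ Uball r m ρ)) := by
  refine (continuous_ext r m).measurable (MeasurableSet.diff ?_ ?_)
  · refine IsClosed.measurableSet ?_
    simp only [BSet, Set.ofPred_and, Set.ofPred_forall]
    exact (isClosed_iInter fun p => isClosed_le (by fun_prop) continuous_const).inter
      (isClosed_iInter fun p => isClosed_iInter fun _ => isClosed_eq (by fun_prop) continuous_const)
  · refine IsClosed.measurableSet ?_
    simp only [Uball, Set.ofPred_forall]
    exact isClosed_iInter fun p => isClosed_le (by fun_prop) continuous_const

lemma continuous_Ffun (r m d : ℕ) : Continuous (Ffun r m d) := by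
  unfold Ffun edgeSum
  fun_prop

lemma integral_outside_le (r m d : ℕ) (hr : 3 ≤ r) (hm : 1 ≤ m) (Q ε ρ I : ℝ)
    (hQ : Q = Lam r m d * (m : ℝ) ^ (r - 1)) (hQ0 : 0 < Q) (hε : 0 ≤ ε) (hε1 : ε ≤ 1 / 2)
    (hρ : 0 ≤ ρ) (hqm : 1 ≤ (1 - ε) * Q * m)
    (hI : ∫ y, Real.exp (-((1 - ε) * Q * (1 - Real.cos y))) ∂arcMeasure ≤ I) (hI0 : 0 < I)
    (hIπ : I ≤ 2 * Real.pi) :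
    (∫ θ in ext r m ⁻¹' (BSet r m \ Uball r m ρ), ‖Ffun r m d (ext r m θ)‖) ≤
      (2 * Real.pi) ^ Fintype.card {p : Fin r × Fin m // ¬ constrained r m p} *
          Real.exp (-(Q * m * ε / 2)) +
        Real.exp (-(Q * ρ ^ 2 / (32 * (r : ℝ) ^ 2))) *
          ((r * m : ℕ) * (Real.sqrt ((1 - ε) * Q * m) ^ r * ((2 * Real.pi) ^ r *
            (2 * Real.pi / I * I ^ Fintype.card
              {p : Fin r × Fin m // ¬ constrained r m p})))) := by
  set ι := {p : Fin r × Fin m // ¬ constrained r m p}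
  set q := (1 - ε) * Q with hq
  have hq0 : 0 < q := mul_pos (by linarith) hQ0
  set a : Fin r × Fin m → ι → ℝ := fun p' i => if i.1 = p' then 0 else 1 with ha
  have ha0 : ∀ p' i, 0 ≤ a p' i := fun p' i => by simp only [ha]; split_ifs <;> norm_num
  set H : Fin r × Fin m → (ι → ℝ) → ℝ := fun p' x => ∫ c : Fin r → ℝ,
    Real.exp (-(q * ∑ i, a p' i * (1 - Real.cos (x i - c i.1.1))))
      ∂Measure.pi fun _ => arcMeasure with hH
  set B : (ι → ℝ) → ℝ := fun x => Real.exp (-(Q * m * ε / 2)) +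
    Real.exp (-(Q * ρ ^ 2 / (32 * (r : ℝ) ^ 2))) * ∑ p', Real.sqrt (q * m) ^ r * H p' x with hB
  have hHint : ∀ p', Integrable (H p') (Measure.pi fun _ => arcMeasure) := fun p' =>
    (integral_integral_centers (fun i : ι => i.1.1) (a p') q hq0 (ha0 p')).1
  have hHsum : Integrable (fun x => Real.exp (-(Q * ρ ^ 2 / (32 * (r : ℝ) ^ 2))) *
      ∑ p', Real.sqrt (q * m) ^ r * H p' x) (Measure.pi fun _ => arcMeasure) :=
    (integrable_finsetSum _ fun p' _ => (hHint p').const_mul _).const_mul _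
  have hBint : Integrable B (Measure.pi fun _ => arcMeasure) :=
    (integrable_const _).add hHsum
  have hcube : (volume : Measure (ι → ℝ)).restrict
      (Set.univ.pi fun _ => Set.Icc (-Real.pi) Real.pi) = Measure.pi fun _ => arcMeasure := by
    rw [volume_pi, Measure.restrict_pi_pi]
  have hsub : ext r m ⁻¹' (BSet r m \ Uball r m ρ) ⊆
      Set.univ.pi fun _ => Set.Icc (-Real.pi) Real.pi := by
    intro θ hθ i _
    have := hθ.1.1 i.1
    rw [ext_coe] at this
    exact abs_le.1 this
  have hB0 : ∀ x, 0 ≤ B x := fun x => by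
    have : ∀ p', 0 ≤ H p' x := fun p' => integral_nonneg fun _ => (Real.exp_pos _).le
    have := Finset.sum_nonneg fun p' (_ : p' ∈ Finset.univ) =>
      mul_nonneg (pow_nonneg (Real.sqrt_nonneg (q * m)) r) (this p')
    positivity
  have hpt : ∀ θ ∈ ext r m ⁻¹' (BSet r m \ Uball r m ρ), ‖Ffun r m d (ext r m θ)‖ ≤ B θ := by
    intro θ hθ
    obtain ⟨c, hc⟩ := exp_energy_le r m d hr hm Q ε ρ hQ hQ0 hε hε1 hρ (ext r m θ) hθ
    refine hc.trans ?_
    simp only [hB]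
    gcongr with p' _
    have hmix := exp_le_sqrt_pow_mul_integral_centers (fun i : ι => i.1.1) (a p') θ c q m hq0
      (ha0 p') (fun t => ?_) hqm
    · rw [Fintype.card_fin] at hmix
      refine le_trans (Real.exp_le_exp.2 (neg_le_neg ?_)) hmix
      refine mul_le_mul_of_nonneg_left ?_ hq0.le
      have hnn : ∀ p : Fin r × Fin m, 0 ≤ (if p = p' then (0 : ℝ) else 1) *
          (1 - Real.cos (ext r m θ p - c p.1)) := fun p =>
        mul_nonneg (by split_ifs <;> norm_num) (sub_nonneg.2 (Real.cos_le_one _))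
      have hinj : Function.Injective (Subtype.val : ι → Fin r × Fin m) := Subtype.val_injective
      refine le_trans (le_of_eq ?_) (Finset.sum_le_sum_of_subset_of_nonneg
        (Finset.subset_univ (Finset.univ.map ⟨_, hinj⟩)) fun p _ _ => hnn p)
      rw [Finset.sum_map]
      refine Finset.sum_congr rfl fun i _ => ?_
      simp only [ha, Function.Embedding.coeFn_mk, ext_coe]
    · calc ∑ i : ι with i.1.1 = t, a p' i ≤ ∑ i : ι with i.1.1 = t, 1 :=
            Finset.sum_le_sum fun i _ => by simp only [ha]; split_ifs <;> norm_num
        _ = ((Finset.univ.filter fun i : ι => i.1.1 = t).card : ℝ) := by simp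
        _ ≤ m := by
          have : (Finset.univ.filter fun i : ι => i.1.1 = t).card ≤
              (Finset.univ : Finset (Fin m)).card := by
            refine Finset.card_le_card_of_injOn (fun i => i.1.2) (fun _ _ => Finset.mem_univ _) ?_
            intro i hi j hj hij
            have hi' : i.1.1 = t := by simpa using hi
            have hj' : j.1.1 = t := by simpa using hj
            exact Subtype.ext (Prod.ext (hi'.trans hj'.symm) hij)
          rw [Finset.card_univ, Fintype.card_fin] at this
          exact_mod_cast this
  have hBon : IntegrableOn B (Set.univ.pi fun _ => Set.Icc (-Real.pi) Real.pi) := by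
    rw [IntegrableOn, hcube]
    exact hBint
  have hFint : IntegrableOn (fun θ => ‖Ffun r m d (ext r m θ)‖)
      (ext r m ⁻¹' (BSet r m \ Uball r m ρ)) := by
    refine ((Continuous.continuousOn ?_).integrableOn_compact
      (isCompact_univ_pi fun _ => isCompact_Icc)).mono_set hsub
    exact ((continuous_Ffun r m d).comp (continuous_ext r m)).norm
  calc _ ≤ ∫ θ in ext r m ⁻¹' (BSet r m \ Uball r m ρ), B θ :=
        setIntegral_mono_on hFint (hBon.mono_set hsub) (measurableSet_outside r m ρ) hpt
    _ ≤ ∫ θ in Set.univ.pi fun _ => Set.Icc (-Real.pi) Real.pi, B θ :=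
        setIntegral_mono_set hBon (Eventually.of_forall hB0) (Eventually.of_forall hsub)
    _ = ∫ θ, B θ ∂Measure.pi fun _ => arcMeasure := by rw [hcube]
    _ ≤ _ := by
        simp only [hB]
        rw [integral_add (integrable_const _) hHsum, integral_const, integral_const_mul,
          integral_finsetSum _ fun p' _ => (hHint p').const_mul _]
        refine add_le_add (le_of_eq ?_) (mul_le_mul_of_nonneg_left ?_ (Real.exp_pos _).le)
        · rw [smul_eq_mul, measureReal_pi_arcMeasure_univ]
        · have hcard : ((r * m : ℕ) : ℝ) = ((Finset.univ : Finset (Fin r × Fin m)).card : ℝ) := by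
            simp
          rw [hcard, ← nsmul_eq_mul]
          refine Finset.sum_le_card_nsmul _ _ _ fun p' _ => ?_
          rw [integral_const_mul]
          refine mul_le_mul_of_nonneg_left ?_ (pow_nonneg (Real.sqrt_nonneg _) r)
          simp only [hH]
          rw [(integral_integral_centers (fun i : ι => i.1.1) (a p') q hq0 (ha0 p')).2,
            Fintype.card_fin]
          refine mul_le_mul_of_nonneg_left ?_ (by positivity)
          exact prod_integral_le (Subtype.val : ι → _) Subtype.val_injective p' q I hI hI0 hIπ

lemma exists_forall_large (c A B : ℝ) (hc : 0 < c) (hA : 0 ≤ A) :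
    ∃ N : ℕ, ∀ n : ℕ, N ≤ n → 2 ≤ c * (n : ℝ) ∧ B ≤ Real.log n ∧
      A * Real.log n ≤ (n : ℝ) / 2 := by
  have h1 : ∀ᶠ n : ℕ in atTop, 2 ≤ c * (n : ℝ) :=
    (tendsto_natCast_atTop_atTop.const_mul_atTop hc).eventually_ge_atTop 2
  have h2 : ∀ᶠ n : ℕ in atTop, B ≤ Real.log n :=
    (Real.tendsto_log_atTop.comp tendsto_natCast_atTop_atTop).eventually_ge_atTop B
  have h3 : ∀ᶠ n : ℕ in atTop, A * Real.log n ≤ (n : ℝ) / 2 := by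
    have h := (Real.isLittleO_log_id_atTop.comp_tendsto
      (tendsto_natCast_atTop_atTop (R := ℝ))).bound
      (by positivity : (0 : ℝ) < 1 / (2 * (A + 1)))
    filter_upwards [h, eventually_ge_atTop 1] with n hn hn1
    have hn1' : (1 : ℝ) ≤ n := by exact_mod_cast hn1
    have hl := Real.log_nonneg hn1'
    simp only [Function.comp_apply, id_eq, Real.norm_eq_abs, abs_of_nonneg hl,
      abs_of_nonneg (zero_le_one.trans hn1')] at hn
    calc A * Real.log n ≤ (A + 1) * (1 / (2 * (A + 1)) * n) := by gcongr; linarith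
      _ = n / 2 := by field_simp
  exact eventually_atTop.1 (h1.and (h2.and h3))

lemma two_pi_le_exp_two : 2 * Real.pi ≤ Real.exp 2 := by
  have h : Real.exp 2 = Real.exp 1 ^ 2 := by rw [← Real.exp_nat_mul]; norm_num
  rw [h]
  nlinarith [Real.exp_one_gt_d9, Real.pi_lt_d2]

/-- Comparison of the one-variable integral with the Gaussian one. -/
lemma integral_exp_le_gaussian (r : ℕ) (Q ε L s n : ℝ) (hr : 3 ≤ r) (hL : 1 ≤ L) (hQ0 : 0 < Q)
    (hε : 0 < ε) (hε1 : ε ≤ 1 / 2) (hn : n = Real.exp L) (hQε : 4 * (r : ℝ) ^ 3 * L ≤ Q * ε)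
    (hs : s = Real.sqrt (2 * Real.pi / Q)) (hsr : Real.exp (-(r * L / 2)) ≤ s) :
    ∫ y, Real.exp (-((1 - ε) * Q * (1 - Real.cos y))) ∂arcMeasure ≤ s * (1 + 2 * ε + 1 / n) := by
  have hr3 : (3 : ℝ) ≤ r := by exact_mod_cast hr
  refine (integral_exp_one_sub_cos_le ((1 - ε) * Q) ε (mul_pos (by linarith) hQ0) hε hε1).trans ?_
  have h1ε : 0 < 1 - ε := by linarith
  have hs0 : 0 ≤ s := hs ▸ Real.sqrt_nonneg _
  have h1 : Real.sqrt (2 * Real.pi / ((1 - ε) * Q * (1 - ε))) ≤ s * (1 + 2 * ε) := by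
    have : 2 * Real.pi / ((1 - ε) * Q * (1 - ε)) = 2 * Real.pi / Q / (1 - ε) ^ 2 := by
      field_simp
    rw [this, Real.sqrt_div (by positivity), Real.sqrt_sq h1ε.le, ← hs, div_le_iff₀ h1ε]
    have : 1 ≤ (1 + 2 * ε) * (1 - ε) := by nlinarith
    nlinarith [mul_le_mul_of_nonneg_left this hs0]
  have h2 : 2 * Real.pi * Real.exp (-((1 - ε) * Q * ε / 5)) ≤ s * (1 / n) := by
    have hexp : 2 * r ^ 3 * L ≤ (1 - ε) * Q * ε := by
      have : 0 ≤ Q * ε := by positivity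
      nlinarith
    have hrL : 18 * (r * L) ≤ 2 * r ^ 3 * L := by
      have : 9 ≤ (r : ℝ) ^ 2 := by nlinarith
      nlinarith [mul_le_mul_of_nonneg_right this (by positivity : 0 ≤ r * L)]
    have hLr : 3 * L ≤ r * L := by gcongr
    calc 2 * Real.pi * Real.exp (-((1 - ε) * Q * ε / 5))
        ≤ Real.exp 2 * Real.exp (-((1 - ε) * Q * ε / 5)) := by
          gcongr; exact two_pi_le_exp_two
      _ ≤ Real.exp (-(r * L / 2)) * Real.exp (-L) := by
          rw [← Real.exp_add, ← Real.exp_add]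
          exact Real.exp_le_exp.2 (by linarith)
      _ ≤ s * (1 / n) := by
          rw [hn, one_div, ← Real.exp_neg]
          gcongr
  linarith

lemma first_term_le (r m N : ℕ) (K L Q ε s : ℝ) (hr : 3 ≤ r) (hm : 1 ≤ m) (hN : N ≤ r * m)
    (hK : 0 < K) (hL : 1 ≤ L) (hQε : Q * ε = (K + 4) * (r : ℝ) ^ 3 * L)
    (hs : Real.exp (-(r * L / 2)) ≤ s) :
    (2 * Real.pi) ^ N * Real.exp (-(Q * m * ε / 2)) ≤ Real.exp (-(K * r * L)) * s ^ N / 2 := by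
  have hr3 : (3 : ℝ) ≤ r := by exact_mod_cast hr
  have hm1 : (1 : ℝ) ≤ m := by exact_mod_cast hm
  have hN' : (N : ℝ) ≤ r * m := by exact_mod_cast hN
  have hexp1 : Real.exp (-1) ≤ 1 / 2 := by
    rw [Real.exp_neg, one_div]
    exact inv_anti₀ (by norm_num) (by linarith [Real.add_one_le_exp 1])
  have h1 : (2 * Real.pi) ^ N ≤ Real.exp (N * (2 + r * L / 2)) * s ^ N := by
    rw [Real.exp_nat_mul, ← mul_pow]
    refine pow_le_pow_left₀ (by positivity) ?_ N
    calc 2 * Real.pi ≤ Real.exp (2 + r * L / 2) * Real.exp (-(r * L / 2)) := by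
          rw [← Real.exp_add, add_neg_cancel_right]; exact two_pi_le_exp_two
      _ ≤ _ := by gcongr
  have hX : (N : ℝ) * (2 + r * L / 2) ≤ r * m * (2 + r * L / 2) := by gcongr
  have hr2 : 9 ≤ (r : ℝ) ^ 2 := by nlinarith
  have e1 : r * m * 9 ≤ (r : ℝ) ^ 3 * m * L := by
    have : (r : ℝ) * m * 9 ≤ r * m * (r ^ 2 * L) := by gcongr; nlinarith
    nlinarith
  have e2 : 3 * (r ^ 2 * m * L) ≤ (r : ℝ) ^ 3 * m * L := by
    nlinarith [mul_le_mul_of_nonneg_right hr3 (by positivity : 0 ≤ (r : ℝ) ^ 2 * m * L)]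
  have e3 : K * r * L * 2 ≤ K * (r ^ 3 * m * L) := by
    have : K * r * L * 2 ≤ K * r * L * (r ^ 2 * m) := by gcongr; nlinarith
    nlinarith
  have e4 : 3 ≤ (r : ℝ) * m := by nlinarith
  have hsum : N * (2 + r * L / 2) - Q * m * ε / 2 ≤ -(K * r * L) + -1 := by
    rw [show Q * m * ε = Q * ε * m by ring, hQε]
    linarith
  have hs0 : 0 ≤ s := (Real.exp_pos _).le.trans hs
  calc (2 * Real.pi) ^ N * Real.exp (-(Q * m * ε / 2))
      ≤ Real.exp (N * (2 + r * L / 2)) * s ^ N * Real.exp (-(Q * m * ε / 2)) := by gcongr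
    _ = Real.exp (N * (2 + r * L / 2) - Q * m * ε / 2) * s ^ N := by
        rw [sub_eq_add_neg, Real.exp_add]; ring
    _ ≤ Real.exp (-(K * r * L) + -1) * s ^ N := by gcongr
    _ = Real.exp (-1) * (Real.exp (-(K * r * L)) * s ^ N) := by rw [Real.exp_add]; ring
    _ ≤ 1 / 2 * (Real.exp (-(K * r * L)) * s ^ N) := by gcongr
    _ = _ := by ring

lemma second_term_le (r N : ℕ) (K L A s ε n w g : ℝ) (hr : 3 ≤ r) (hN : (N : ℝ) ≤ n)
    (hn : n = Real.exp L) (hA : 0 ≤ A) (hK : 0 < K) (hL : 1 ≤ L)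
    (hLA : 32 * (7 + 2 * A + K) ≤ L) (hε : 0 < ε) (hnε : n * ε ≤ A * L)
    (hs : Real.exp (-(r * L / 2)) ≤ s) (hw0 : 0 ≤ w) (hw : w ≤ Real.exp (r * L / 2))
    (hg : g = (r : ℝ) ^ 3 * L ^ 2 / 32) :
    Real.exp (-g) * (n * (w ^ r * ((2 * Real.pi) ^ r *
      (2 * Real.pi / (s * (1 + 2 * ε + 1 / n)) * (s * (1 + 2 * ε + 1 / n)) ^ N)))) ≤
      Real.exp (-(K * r * L)) * s ^ N / 2 := by
  have hr3 : (3 : ℝ) ≤ r := by exact_mod_cast hr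
  have hs0 : 0 < s := (Real.exp_pos _).trans_le hs
  have hn0 : 0 < n := hn ▸ Real.exp_pos _
  have hexp1 : Real.exp (-1) ≤ 1 / 2 := by
    rw [Real.exp_neg, one_div]
    exact inv_anti₀ (by norm_num) (by linarith [Real.add_one_le_exp 1])
  have h1 : w ^ r * (2 * Real.pi) ^ r ≤ Real.exp (r * (r * L / 2 + 2)) := by
    rw [Real.exp_nat_mul, ← mul_pow, Real.exp_add]
    gcongr
    exact two_pi_le_exp_two
  have h2 : 2 * Real.pi / (s * (1 + 2 * ε + 1 / n)) ≤ Real.exp (2 + r * L / 2) := by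
    rw [div_le_iff₀ (by positivity)]
    calc 2 * Real.pi ≤ Real.exp (2 + r * L / 2) * Real.exp (-(r * L / 2)) := by
          rw [← Real.exp_add, add_neg_cancel_right]; exact two_pi_le_exp_two
      _ ≤ Real.exp (2 + r * L / 2) * (s * 1) := by rw [mul_one]; gcongr
      _ ≤ _ := by
          gcongr
          have : 0 < 1 / n := by positivity
          linarith
  have h3 : (s * (1 + 2 * ε + 1 / n)) ^ N ≤ s ^ N * Real.exp (2 * (A * L) + 1) := by
    rw [mul_pow]
    gcongr
    calc (1 + 2 * ε + 1 / n) ^ N ≤ Real.exp (2 * ε + 1 / n) ^ N := by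
          gcongr
          linarith [Real.add_one_le_exp (2 * ε + 1 / n)]
      _ = Real.exp (N * (2 * ε + 1 / n)) := by rw [Real.exp_nat_mul]
      _ ≤ Real.exp (2 * (A * L) + 1) := by
          refine Real.exp_le_exp.2 ?_
          calc (N : ℝ) * (2 * ε + 1 / n) ≤ n * (2 * ε + 1 / n) := by gcongr
            _ = 2 * (n * ε) + 1 := by field_simp
            _ ≤ _ := by linarith
  have hsum : -g + (L + (r * (r * L / 2 + 2) + (2 + r * L / 2 + (2 * (A * L) + 1)))) ≤
      -(K * r * L) + -1 := by
    have hr2 : 9 ≤ (r : ℝ) ^ 2 := by nlinarith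
    have a0 : r * L * 9 ≤ (r : ℝ) ^ 3 * L := by
      nlinarith [mul_le_mul_of_nonneg_left hr2 (by positivity : 0 ≤ r * L)]
    have a1 : 3 * L ≤ r * L := by gcongr
    have a2 : (r : ℝ) ≤ r * L := by nlinarith
    have a3 : 3 * (r ^ 2 * L) ≤ (r : ℝ) ^ 3 * L := by
      nlinarith [mul_le_mul_of_nonneg_right hr3 (by positivity : 0 ≤ (r : ℝ) ^ 2 * L)]
    have a4 : A * L ≤ A * (r ^ 3 * L) := by
      gcongr
      linarith
    have a5 : K * (r * L) ≤ K * (r ^ 3 * L) := by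
      gcongr K * ?_
      nlinarith
    have a6 := mul_le_mul_of_nonneg_left hLA (by positivity : 0 ≤ (r : ℝ) ^ 3 * L)
    rw [hg]
    nlinarith
  calc _ = Real.exp (-g) * (n * ((w ^ r * (2 * Real.pi) ^ r) *
        (2 * Real.pi / (s * (1 + 2 * ε + 1 / n)) * (s * (1 + 2 * ε + 1 / n)) ^ N))) := by ring
    _ ≤ Real.exp (-g) * (Real.exp L * (Real.exp (r * (r * L / 2 + 2)) *
        (Real.exp (2 + r * L / 2) * (s ^ N * Real.exp (2 * (A * L) + 1))))) := by
        rw [← hn]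
        gcongr
    _ = Real.exp (-g + (L + (r * (r * L / 2 + 2) + (2 + r * L / 2 + (2 * (A * L) + 1))))) *
        s ^ N := by
        simp only [Real.exp_add]
        ring
    _ ≤ Real.exp (-(K * r * L) + -1) * s ^ N := by gcongr
    _ = Real.exp (-1) * (Real.exp (-(K * r * L)) * s ^ N) := by rw [Real.exp_add]; ring
    _ ≤ 1 / 2 * (Real.exp (-(K * r * L)) * s ^ N) := by gcongr
    _ = _ := by ring

lemma mul_rho0_sq_div (r m d : ℕ) (hr : 1 ≤ r) (hQ : 0 < Lam r m d * (m : ℝ) ^ (r - 1)) :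
    Lam r m d * (m : ℝ) ^ (r - 1) * rho0 r m d ^ 2 / (32 * (r : ℝ) ^ 2) =
      (r : ℝ) ^ 3 * Real.log ((r : ℝ) * m) ^ 2 / 32 := by
  have hr0 : (0 : ℝ) < r := by exact_mod_cast hr
  have h5 : ((r : ℝ) ^ ((5 : ℝ) / 2)) ^ 2 = (r : ℝ) ^ 5 := by
    rw [← Real.rpow_natCast, ← Real.rpow_mul hr0.le, ← Real.rpow_natCast]
    norm_num
  rw [rho0, div_pow, mul_pow, h5, Real.sq_sqrt hQ.le]
  generalize Lam r m d * (m : ℝ) ^ (r - 1) = Q at hQ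
  field_simp

lemma sqrt_pow_card_le_denseBound (r m d N : ℕ) (hr : 1 ≤ r) (hm : 1 ≤ m)
    (hN : N + r = r * m + 1) (hQ : 0 < Lam r m d * (m : ℝ) ^ (r - 1)) :
    Real.sqrt (2 * Real.pi / (Lam r m d * (m : ℝ) ^ (r - 1))) ^ N ≤ denseBound r m d := by
  have hr1 : (1 : ℝ) ≤ r := by exact_mod_cast hr
  have hm1 : (1 : ℝ) ≤ m := by exact_mod_cast hm
  have hexp : (((r * m : ℕ) : ℝ) - (r : ℝ) + 1) = N := by
    have : (N : ℝ) + r = ((r * m : ℕ) : ℝ) + 1 := by exact_mod_cast hN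
    linarith
  rw [denseBound, hexp]
  generalize Lam r m d * (m : ℝ) ^ (r - 1) = Q at hQ
  have hpow : Real.sqrt (2 * Real.pi / Q) ^ N = (2 * Real.pi / Q) ^ ((N : ℝ) / 2) := by
    rw [Real.sqrt_eq_rpow, ← Real.rpow_natCast, ← Real.rpow_mul (by positivity)]
    congr 1
    ring
  rw [hpow]
  exact le_mul_of_one_le_left (by positivity) (Real.one_le_rpow hm1 (by linarith))

set_option maxHeartbeats 1000000 in
/-- for all `c, K > 0` there is `N` such that whenever `n = rm ≥ N`,
`r ≥ 3`, `1 ≤ d ≤ m^{r−1} − 1` and `Λ ≥ c·r^16·m^{2−r}`,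
`∫_{𝓑 \ U_n(ρ₀)} |F| ≤ e^{−K r log n} · m^{(r−1)/2} (2π/(Λ m^{r−1}))^{(n−r+1)/2}`. -/
theorem abs_integral_outside_bound (c K : ℝ) (hc : 0 < c) (hK : 0 < K) :
    ∃ N : ℕ, ∀ r m d : ℕ, 3 ≤ r → 1 ≤ m → N ≤ r * m →
      1 ≤ d → d ≤ m ^ (r - 1) - 1 →
      c * (r : ℝ) ^ 16 * (m : ℝ) ^ ((2 : ℤ) - (r : ℤ)) ≤ Lam r m d →
      (∫ θ in ext r m ⁻¹' (BSet r m \ Uball r m (rho0 r m d)),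
          ‖Ffun r m d (ext r m θ)‖) ≤
        Real.exp (-(K * (r : ℝ) * Real.log ((r : ℝ) * m))) * denseBound r m d := by
  set A := (K + 4) / c with hA
  have hA0 : 0 ≤ A := by positivity
  obtain ⟨N₀, hN₀⟩ := exists_forall_large c A (32 * (7 + 2 * A + K)) hc hA0
  refine ⟨N₀, fun r m d hr hm hN hd hdm hΛ => ?_⟩
  obtain ⟨hcn, hLA, hAL⟩ := hN₀ _ hN
  set L := Real.log ((r : ℝ) * m) with hL
  rw [show Real.log ((r * m : ℕ) : ℝ) = L by rw [hL]; push_cast; rfl] at hLA hAL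
  push_cast at hcn hAL
  have hr3 : (3 : ℝ) ≤ r := by exact_mod_cast hr
  have hm1 : (1 : ℝ) ≤ m := by exact_mod_cast hm
  have hm0 : (0 : ℝ) < m := by linarith
  have hn1 : 1 ≤ (r : ℝ) * m := one_le_mul_of_one_le_of_one_le (by linarith) hm1
  have hn0 : 0 < (r : ℝ) * m := zero_lt_one.trans_le hn1
  have hn : (r : ℝ) * m = Real.exp L := (Real.exp_log hn0).symm
  have hL1 : 1 ≤ L := by linarith
  set Q := Lam r m d * (m : ℝ) ^ (r - 1) with hQ
  have hmr : (m : ℝ) ^ r = (m : ℝ) ^ (r - 1) * m := by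
    rw [← pow_succ, Nat.sub_add_cancel (by omega)]
  have hQlow : c * (r : ℝ) ^ 16 * m ≤ Q := by
    refine le_trans (le_of_eq ?_) (mul_le_mul_of_nonneg_right hΛ (by positivity))
    rw [mul_assoc (c * (r : ℝ) ^ 16), ← zpow_natCast (m : ℝ) (r - 1), ← zpow_add₀ hm0.ne', Nat.cast_sub (by omega)]
    norm_num
  have hcn16 : c * (r * m) ≤ c * (r : ℝ) ^ 16 * m := by
    rw [← mul_assoc]
    gcongr
    exact le_self_pow₀ (by linarith) (by norm_num)
  have hQ2 : 2 ≤ Q := by linarith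
  have hQ0 : 0 < Q := by linarith
  have hQup : Q * m ≤ Real.exp (r * L) := by
    have hΛ1 : Lam r m d ≤ 1 := by
      rw [Lam]
      nlinarith [sq_nonneg (lam r m d - 1 / 2)]
    calc Q * m = Lam r m d * (m : ℝ) ^ r := by rw [hQ, hmr]; ring
      _ ≤ 1 * (r * m : ℝ) ^ r := by gcongr; nlinarith
      _ = Real.exp (r * L) := by rw [Real.exp_nat_mul, ← hn, one_mul]
  have hsqrt_exp : Real.sqrt (Real.exp (r * L)) = Real.exp (r * L / 2) := by
    rw [Real.sqrt_eq_iff_mul_self_eq (Real.exp_pos _).le (Real.exp_pos _).le, ← Real.exp_add]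
    ring_nf
  set s := Real.sqrt (2 * Real.pi / Q) with hs
  have hsr : Real.exp (-(r * L / 2)) ≤ s := by
    rw [Real.exp_neg, ← hsqrt_exp, ← Real.sqrt_inv, hs]
    refine Real.sqrt_le_sqrt ?_
    have h1 : Q ≤ Real.exp (r * L) := by nlinarith
    rw [inv_eq_one_div]
    gcongr
    linarith [Real.pi_gt_three]
  have hs0 : 0 < s := (Real.exp_pos _).trans_le hsr
  have hs2 : s ≤ 2 := by
    rw [hs, Real.sqrt_le_left (by norm_num), div_le_iff₀ hQ0]
    nlinarith [Real.pi_lt_four]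
  set ε := (K + 4) * (r : ℝ) ^ 3 * L / Q with hε
  have hQε : Q * ε = (K + 4) * (r : ℝ) ^ 3 * L := by rw [hε]; field_simp
  have hε0 : 0 < ε := by positivity
  have hnε : r * m * ε ≤ A * L := by
    rw [hε, hA, ← mul_div_assoc, div_mul_eq_mul_div, div_le_div_iff₀ hQ0 hc]
    have h4 : (r : ℝ) ^ 4 ≤ r ^ 16 := pow_le_pow_right₀ (by linarith) (by norm_num)
    calc r * m * ((K + 4) * (r : ℝ) ^ 3 * L) * c = (K + 4) * L * (c * (r : ℝ) ^ 4 * m) := by ring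
      _ ≤ (K + 4) * L * (c * (r : ℝ) ^ 16 * m) := by gcongr
      _ ≤ (K + 4) * L * Q := by gcongr
  have hε1 : ε ≤ 1 / 2 := by
    have h1 : r * m * ε ≤ r * m * (1 / 2) := by linarith
    exact le_of_mul_le_mul_left h1 hn0
  have hqm : 1 ≤ (1 - ε) * Q * m := by
    have h1 : 1 ≤ (1 - ε) * Q := by nlinarith
    nlinarith
  set I := s * (1 + 2 * ε + 1 / (r * m)) with hI
  have hI0 : 0 < I := by positivity
  have hIπ : I ≤ 2 * Real.pi := by
    have h1 : 1 / (r * m : ℝ) ≤ 1 := (div_le_one hn0).2 hn1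
    have : I ≤ 2 * 3 := by
      rw [hI]
      gcongr
      linarith
    exact this.trans (mul_le_mul_of_nonneg_left Real.pi_gt_three.le zero_le_two)
  have hρ : Q * rho0 r m d ^ 2 / (32 * (r : ℝ) ^ 2) = (r : ℝ) ^ 3 * L ^ 2 / 32 :=
    mul_rho0_sq_div r m d (by omega) hQ0
  have hρ0 : 0 ≤ rho0 r m d := by
    rw [rho0]
    positivity
  set N := Fintype.card {p : Fin r × Fin m // ¬ constrained r m p} with hNdef
  have hcard : N + r = r * m + 1 := card_free r m (by omega) hm
  have hNle : N ≤ r * m := by omega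
  refine (integral_outside_le r m d hr hm Q ε (rho0 r m d) I hQ hQ0 hε0.le hε1 hρ0 hqm
    (integral_exp_le_gaussian r Q ε L s _ hr hL1 hQ0 hε0 hε1 hn ?_ hs hsr) hI0 hIπ).trans ?_
  · rw [hQε]
    gcongr
    linarith
  rw [← hNdef]
  have hT1 := first_term_le r m N K L Q ε s hr hm hNle hK hL1 hQε hsr
  have hw : Real.sqrt ((1 - ε) * Q * m) ≤ Real.exp (r * L / 2) := by
    rw [← hsqrt_exp]
    refine Real.sqrt_le_sqrt (le_trans ?_ hQup)
    gcongr
    nlinarith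
  have hT2 := second_term_le r N K L A s ε (r * m) _ _ hr (by exact_mod_cast hNle) hn hA0 hK hL1
    hLA hε0 hnε hsr (Real.sqrt_nonneg _) hw hρ
  have hdense : s ^ N ≤ denseBound r m d :=
    sqrt_pow_card_le_denseBound r m d N (by omega) hm hcard hQ0
  push_cast
  calc _ ≤ Real.exp (-(K * r * L)) * s ^ N / 2 + Real.exp (-(K * r * L)) * s ^ N / 2 :=
        add_le_add hT1 hT2
    _ = Real.exp (-(K * r * L)) * s ^ N := by ring
    _ ≤ _ := by gcongr
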